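/- arXiv:2109.11811 — 2 statements merged into one kernel-verified Lean document; each statement's English description precedes it below -/
import Mathlib

section
/- Let ξ ∈ ℂⁿ be a standard complex Gaussian vector (each coordinate has independent N(0,1/2) real and imaginary parts), and let x, h be unit vectors in ℂⁿ with Im(h*x) = 0. Then for any 0 < λ ≤ √((5−√21)/2), E[|ξ*h|² · 1{|ξ*x| ≤ λ|ξ*h|}] ≤ λ²(λ²+2)/(λ²+1)² ≤ 2λ²/(λ²+1). -/
open MeasureTheory ProbabilityTheory

/-- The standard complex Gaussian on ℂ: independent N(0,1/2) real and imaginary parts. -/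
noncomputable def complexStdGaussian : Measure ℂ :=
  ((gaussianReal 0 (1/2)).prod (gaussianReal 0 (1/2))).map
    (fun p : ℝ × ℝ => (p.1 : ℂ) + (p.2 : ℂ) * Complex.I)

/-- The standard complex Gaussian vector measure on ℂⁿ. -/
noncomputable def complexStdGaussianVec (n : ℕ) : Measure (Fin n → ℂ) :=
  Measure.pi fun _ => complexStdGaussian

lemma one_add_mul_div_add_le {P Q : ℝ} (hP : 0 ≤ P) (hQ : 0 ≤ Q) (h : P + Q < 1) :
    P * (6 - 3 * P + P ^ 2) / (1 - P) ^ 3 + Q * (6 - 3 * Q + Q ^ 2) / (1 - Q) ^ 3 ≤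
      (P + Q) * (6 - 3 * (P + Q) + (P + Q) ^ 2) / (1 - (P + Q)) ^ 3 := by
  have key : ∀ y t : ℝ, y ≤ t → t < 1 →
      (6 - 3 * y + y ^ 2) / (1 - y) ^ 3 ≤ (6 - 3 * t + t ^ 2) / (1 - t) ^ 3 := by
    intro y t hyt ht
    have e : ∀ w : ℝ, w < 1 → (6 - 3 * w + w ^ 2) / (1 - w) ^ 3 =
        1 / (1 - w) + 1 / (1 - w) ^ 2 + 4 / (1 - w) ^ 3 := by
      intro w hw
      have : 1 - w ≠ 0 := by linarith
      field_simp
      ring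
    have h1 : 0 < 1 - t := by linarith
    rw [e y (by linarith), e t ht]
    gcongr
  have h1 := mul_le_mul_of_nonneg_left (key P (P + Q) (by linarith) h) hP
  have h2 := mul_le_mul_of_nonneg_left (key Q (P + Q) (by linarith) h) hQ
  have e3 : (P + Q) * (6 - 3 * (P + Q) + (P + Q) ^ 2) / (1 - (P + Q)) ^ 3 =
    P * ((6 - 3 * (P + Q) + (P + Q) ^ 2) / (1 - (P + Q)) ^ 3) +
    Q * ((6 - 3 * (P + Q) + (P + Q) ^ 2) / (1 - (P + Q)) ^ 3) := by ring
  rw [e3, mul_div_assoc, mul_div_assoc]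
  exact add_le_add h1 h2

lemma sq_mul_two_add_le {s t : ℝ} (hs : 0 ≤ s) (hs1 : s < 1) (ht : 0 ≤ t) (hts : t ≤ 4 / 7 * s) :
    (1 - s) ^ 2 * (2 + t * (6 - 3 * t + t ^ 2) / (1 - t) ^ 3) ≤ 2 := by
  obtain ⟨T, hT⟩ : ∃ T, T = 4 / 7 * s := ⟨_, rfl⟩
  rw [← hT] at hts
  have h1 := one_add_mul_div_add_le ht (sub_nonneg.2 hts) (by linarith)
  have h2 : 0 ≤ (T - t) * (6 - 3 * (T - t) + (T - t) ^ 2) / (1 - (T - t)) ^ 3 :=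
    div_nonneg (mul_nonneg (by linarith) (by nlinarith)) (pow_nonneg (by linarith) 3)
  rw [add_sub_cancel] at h1
  have h3 : (1 - s) ^ 2 * (2 + T * (6 - 3 * T + T ^ 2) / (1 - T) ^ 3) ≤ 2 := by
    have hp : 0 < 1 - T := by linarith
    have e : (1 - s) ^ 2 * (2 + T * (6 - 3 * T + T ^ 2) / (1 - T) ^ 3) =
        (1 - s) ^ 2 * (2 + 3 * T ^ 2 - T ^ 3) / (1 - T) ^ 3 := by
      field_simp
      ring
    rw [e, div_le_iff₀ (pow_pos hp 3), ← sub_nonneg]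
    have q : 0 ≤ 196 - 350 * s + 608 * s ^ 2 - 464 * s ^ 3 + 64 * s ^ 4 := by
      nlinarith [mul_nonneg (mul_nonneg hs hs) (sub_nonneg.2 hs1.le), sq_nonneg (s - 1 / 2),
        mul_nonneg hs (sq_nonneg (s - 1 / 2)), sq_nonneg (s * (s - 1)),
        mul_nonneg (sub_nonneg.2 hs1.le) (sq_nonneg (s - 1 / 2))]
    have e' : 2 * (1 - T) ^ 3 - (1 - s) ^ 2 * (2 + 3 * T ^ 2 - T ^ 3) =
        s / 343 * (196 - 350 * s + 608 * s ^ 2 - 464 * s ^ 3 + 64 * s ^ 4) := by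
      rw [hT]; ring
    rw [e']
    positivity
  have h4 := mul_le_mul_of_nonneg_left ((le_add_of_nonneg_right h2).trans h1) (sq_nonneg (1 - s))
  linarith

/-- Averaging over the four rotations of `p + q * I` by powers of `I`. -/
lemma sum_rotations_le {σ p q : ℝ} (hσ : σ ^ 2 < 1)
    (hr : 7 * (p ^ 2 + q ^ 2) ≤ (1 + (p ^ 2 + q ^ 2)) ^ 2) :
    (1 - σ ^ 2) ^ 2 * (((1 + (p ^ 2 + q ^ 2) - 2 * σ * p) ^ 3)⁻¹ +
      ((1 + (p ^ 2 + q ^ 2) + 2 * σ * p) ^ 3)⁻¹ + ((1 + (p ^ 2 + q ^ 2) - 2 * σ * q) ^ 3)⁻¹ +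
      ((1 + (p ^ 2 + q ^ 2) + 2 * σ * q) ^ 3)⁻¹) ≤ 4 * ((1 + (p ^ 2 + q ^ 2)) ^ 3)⁻¹ := by
  obtain ⟨A, hA⟩ : ∃ A, A = 1 + (p ^ 2 + q ^ 2) := ⟨_, rfl⟩
  have hA0 : 0 < A := by rw [hA]; positivity
  rw [← hA] at hr ⊢
  have pair : ∀ y : ℝ, (2 * σ * y / A) ^ 2 < 1 →
      ((A - 2 * σ * y) ^ 3)⁻¹ + ((A + 2 * σ * y) ^ 3)⁻¹ = 2 * (A ^ 3)⁻¹ *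
        (1 + (2 * σ * y / A) ^ 2 * (6 - 3 * (2 * σ * y / A) ^ 2 + ((2 * σ * y / A) ^ 2) ^ 2) /
          (1 - (2 * σ * y / A) ^ 2) ^ 3) := by
    intro y hy
    obtain ⟨b, hb⟩ : ∃ b, b = 2 * σ * y / A := ⟨_, rfl⟩
    have hb' : 2 * σ * y = A * b := by rw [hb]; field_simp
    rw [← hb] at hy ⊢
    have hb1 := abs_lt.1 ((sq_lt_one_iff_abs_lt_one b).1 hy)
    have h1 : 1 - b ≠ 0 := by linarith
    have h2 : 1 + b ≠ 0 := by linarith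
    have h3 : 1 - b ^ 2 = (1 - b) * (1 + b) := by ring
    rw [hb', h3, show A - A * b = A * (1 - b) by ring, show A + A * b = A * (1 + b) by ring]
    field_simp
    ring
  obtain ⟨P, hP⟩ : ∃ P, P = (2 * σ * p / A) ^ 2 := ⟨_, rfl⟩
  obtain ⟨Q, hQ⟩ : ∃ Q, Q = (2 * σ * q / A) ^ 2 := ⟨_, rfl⟩
  have hP0 : 0 ≤ P := hP ▸ sq_nonneg _
  have hQ0 : 0 ≤ Q := hQ ▸ sq_nonneg _
  have hPQ : P + Q ≤ 4 / 7 * σ ^ 2 := by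
    have : P + Q = σ ^ 2 * (4 * (p ^ 2 + q ^ 2) / A ^ 2) := by
      rw [hP, hQ]; field_simp; ring
    rw [this, mul_comm (4 / 7)]
    refine mul_le_mul_of_nonneg_left ?_ (sq_nonneg σ)
    rw [div_le_iff₀ (by positivity)]
    linarith
  have e1 := pair p (by rw [← hP]; linarith)
  have e2 := pair q (by rw [← hQ]; linarith)
  rw [← hP] at e1
  rw [← hQ] at e2
  rw [add_assoc, e1, e2]
  have h1 := one_add_mul_div_add_le hP0 hQ0 (by linarith)
  have h2 := sq_mul_two_add_le (sq_nonneg σ) hσ (add_nonneg hP0 hQ0) hPQ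
  have h3 := mul_le_mul_of_nonneg_left h1 (sq_nonneg (1 - σ ^ 2))
  have h4 : (1 - σ ^ 2) ^ 2 * (2 + (P * (6 - 3 * P + P ^ 2) / (1 - P) ^ 3 +
      Q * (6 - 3 * Q + Q ^ 2) / (1 - Q) ^ 3)) ≤ 2 := by linarith
  have h5 := mul_le_mul_of_nonneg_left h4 (by positivity : 0 ≤ 2 * (A ^ 3)⁻¹)
  linarith

section
open Complex
open scoped ComplexConjugate ENNReal

instance : IsProbabilityMeasure complexStdGaussian :=
  Measure.isProbabilityMeasure_map (by fun_prop)

lemma integral_cexp_re_complexStdGaussian (u : ℂ) :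
    ∫ z, cexp ((z * u).re * I) ∂complexStdGaussian = cexp (-(‖u‖ ^ 2 : ℝ) / 4) := by
  rw [complexStdGaussian, integral_map (by fun_prop) (by fun_prop)]
  have h : ∀ p : ℝ × ℝ, cexp ((((p.1 : ℂ) + (p.2 : ℂ) * I) * u).re * I) =
      cexp (u.re * p.1 * I) * cexp ((-u.im : ℝ) * p.2 * I) := by
    intro p
    rw [← Complex.exp_add]
    congr 1
    simp
    ring
  simp_rw [h]
  rw [integral_prod_mul (fun x : ℝ => cexp (u.re * x * I)) (fun y : ℝ => cexp ((-u.im : ℝ) * y * I)),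
    ← charFun_apply_real, ← charFun_apply_real, charFun_gaussianReal, charFun_gaussianReal,
    ← Complex.exp_add, ← normSq_eq_norm_sq, normSq_apply]
  congr 1
  push_cast
  ring

instance (n : ℕ) : IsProbabilityMeasure (complexStdGaussianVec n) := by
  unfold complexStdGaussianVec
  infer_instance

lemma integral_cexp_re_complexStdGaussianVec {n : ℕ} (w : Fin n → ℂ) :
    ∫ ξ, cexp ((∑ j, ξ j * w j).re * I) ∂complexStdGaussianVec n =
      cexp (-(∑ j, ‖w j‖ ^ 2 : ℝ) / 4) := by
  have e : ∀ ξ : Fin n → ℂ, cexp ((∑ j, ξ j * w j).re * I) = ∏ j, cexp ((ξ j * w j).re * I) := by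
    intro ξ
    rw [← Complex.exp_sum, ← Finset.sum_mul, ← ofReal_sum, ← re_sum]
  rw [integral_congr_ae (ae_of_all _ e), complexStdGaussianVec, integral_fintype_prod_eq_prod
    (fun j (z : ℂ) => cexp ((z * w j).re * I))]
  simp_rw [integral_cexp_re_complexStdGaussian]
  rw [← Complex.exp_sum, ← Finset.sum_div]
  simp

lemma exists_strongDual_prod_eq_re (L : StrongDual ℝ (ℂ × ℂ)) :
    ∃ u v : ℂ, ∀ p : ℂ × ℂ, L p = (p.1 * u).re + (p.2 * v).re := by
  refine ⟨L (1, 0) - L (I, 0) * I, L (0, 1) - L (0, I) * I, fun p => ?_⟩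
  have hp : p = p.1.re • ((1, 0) : ℂ × ℂ) + p.1.im • ((I, 0) : ℂ × ℂ) +
      p.2.re • ((0, 1) : ℂ × ℂ) + p.2.im • ((0, I) : ℂ × ℂ) := by
    ext <;> simp
  conv_lhs => rw [hp]
  simp only [map_add, map_smul, smul_eq_mul]
  simp
  ring

lemma sum_norm_sq_conj_add {n : ℕ} {h y : Fin n → ℂ} (hh : ∑ j, ‖h j‖ ^ 2 = 1)
    (hy : ∑ j, ‖y j‖ ^ 2 = 1) (hhy : ∑ j, conj (h j) * y j = 0) (u v : ℂ) :
    ∑ j, ‖conj (h j * u + y j * v)‖ ^ 2 = ‖u‖ ^ 2 + ‖v‖ ^ 2 := by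
  have e : ∀ j, ‖conj (h j * u + y j * v)‖ ^ 2 = ‖h j‖ ^ 2 * ‖u‖ ^ 2 + ‖y j‖ ^ 2 * ‖v‖ ^ 2 +
      2 * (conj (h j) * y j * (conj u * v)).re := by
    intro j
    simp only [← normSq_eq_norm_sq, normSq_apply]
    simp
    ring
  simp_rw [e]
  rw [Finset.sum_add_distrib, Finset.sum_add_distrib, ← Finset.sum_mul, ← Finset.sum_mul, hh, hy,
    ← Finset.mul_sum, ← re_sum, ← Finset.sum_mul, hhy]
  simp

/-- The coordinates of a standard complex Gaussian vector along an orthonormal pair are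
independent standard complex Gaussians. -/
lemma complexStdGaussianVec_map_prod {n : ℕ} {h y : Fin n → ℂ}
    (hh : ∑ j, ‖h j‖ ^ 2 = 1) (hy : ∑ j, ‖y j‖ ^ 2 = 1) (hhy : ∑ j, conj (h j) * y j = 0) :
    (complexStdGaussianVec n).map
      (fun ξ => (∑ j, conj (ξ j) * h j, ∑ j, conj (ξ j) * y j)) =
    complexStdGaussian.prod complexStdGaussian := by
  have hm : Measurable fun ξ : Fin n → ℂ => (∑ j, conj (ξ j) * h j, ∑ j, conj (ξ j) * y j) := by
    have : Continuous fun ξ : Fin n → ℂ => (∑ j, conj (ξ j) * h j, ∑ j, conj (ξ j) * y j) := by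
      fun_prop
    exact this.measurable
  have := Measure.isProbabilityMeasure_map (μ := complexStdGaussianVec n) hm.aemeasurable
  refine Measure.ext_of_charFunDual ?_
  ext L
  obtain ⟨u, v, hL⟩ := exists_strongDual_prod_eq_re L
  rw [charFunDual_apply, charFunDual_apply, integral_map hm.aemeasurable (by fun_prop)]
  have e1 : ∀ p : ℂ × ℂ, cexp (L p * I) = cexp ((p.1 * u).re * I) * cexp ((p.2 * v).re * I) := by
    intro p
    rw [← Complex.exp_add, hL, ofReal_add, add_mul]
  have e2 : ∀ ξ : Fin n → ℂ,
      cexp (L (∑ j, conj (ξ j) * h j, ∑ j, conj (ξ j) * y j) * I) =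
        cexp ((∑ j, ξ j * conj (h j * u + y j * v)).re * I) := by
    intro ξ
    rw [hL, ← add_re, Finset.sum_mul, Finset.sum_mul, ← Finset.sum_add_distrib, re_sum, re_sum]
    congr 3
    refine Finset.sum_congr rfl fun j _ => ?_
    rw [← conj_re]
    congr 1
    simp
    ring
  rw [integral_congr_ae (ae_of_all _ e1), integral_congr_ae (ae_of_all _ e2),
    integral_prod_mul (fun z : ℂ => cexp ((z * u).re * I)) (fun z : ℂ => cexp ((z * v).re * I)),
    integral_cexp_re_complexStdGaussian, integral_cexp_re_complexStdGaussian,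
    integral_cexp_re_complexStdGaussianVec, sum_norm_sq_conj_add hh hy hhy, ← Complex.exp_add]
  congr 1
  push_cast
  ring

lemma lintegral_complexStdGaussian {f : ℂ → ℝ≥0∞} (hf : Measurable f) :
    ∫⁻ z, f z ∂complexStdGaussian =
      ∫⁻ z, ENNReal.ofReal (Real.pi⁻¹ * Real.exp (-‖z‖ ^ 2)) * f z := by
  have hv : (1 / 2 : NNReal) ≠ 0 := by norm_num
  have hm : Measurable fun p : ℝ × ℝ => (p.1 : ℂ) + (p.2 : ℂ) * I := by fun_prop
  have hfm : Measurable fun p : ℝ × ℝ => f ((p.1 : ℂ) + (p.2 : ℂ) * I) := hf.comp hm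
  have he : ∀ p : ℝ × ℝ, measurableEquivRealProd.symm p = (p.1 : ℂ) + (p.2 : ℂ) * I := by
    intro p
    apply Complex.ext <;> simp [measurableEquivRealProd]
  rw [← (volume_preserving_equiv_real_prod.symm).lintegral_comp (by fun_prop),
    complexStdGaussian, lintegral_map hf hm, gaussianReal_of_var_ne_zero 0 hv,
    prod_withDensity (by fun_prop) (by fun_prop), 
    lintegral_withDensity_eq_lintegral_mul _ (by fun_prop) hfm]
  refine lintegral_congr fun p => ?_
  simp only [he, Pi.mul_apply]
  congr 1
  rw [gaussianPDF, gaussianPDF, ← ENNReal.ofReal_mul (gaussianPDFReal_nonneg _ _ _)]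
  congr 1
  rw [gaussianPDFReal, gaussianPDFReal, ← normSq_eq_norm_sq, normSq_add_mul_I]
  have h2 : (2 * Real.pi * ((1 / 2 : NNReal) : ℝ)) = Real.pi := by push_cast; ring
  rw [h2, mul_mul_mul_comm, ← mul_inv, Real.mul_self_sqrt Real.pi_pos.le, ← Real.exp_add]
  congr 2
  push_cast
  ring

lemma lintegral_mul_add_complex {k : ℂ} (hk : k ≠ 0) (d : ℂ) {f : ℂ → ℝ≥0∞} (hf : Measurable f) :
    ∫⁻ z, f z = ENNReal.ofReal (‖k‖ ^ 2) * ∫⁻ z, f (k * z + d) := by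
  have hdet : LinearMap.det (LinearMap.mulLeft ℝ k) = ‖k‖ ^ 2 := by
    rw [← normSq_eq_norm_sq, ← Algebra.norm_complex_apply]
    rfl
  have hk' : 0 < ‖k‖ ^ 2 := by positivity
  have h := Measure.map_linearMap_addHaar_eq_smul_addHaar (volume : Measure ℂ)
    (f := LinearMap.mulLeft ℝ k) (by rw [hdet]; exact hk'.ne')
  rw [hdet, abs_of_pos (inv_pos.2 hk')] at h
  have hm : Measurable fun z : ℂ => f (z + d) := hf.comp (by fun_prop)
  have hl : Measurable (LinearMap.mulLeft ℝ k) := by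
    change Measurable fun z => k * z
    fun_prop
  have e : ∫⁻ z, f (k * z + d) =
      ∫⁻ z, f (z + d) ∂((volume : Measure ℂ).map (LinearMap.mulLeft ℝ k)) := by
    rw [lintegral_map hm hl]
    rfl
  rw [e, h, lintegral_smul_measure, smul_eq_mul, ← mul_assoc, ← ENNReal.ofReal_mul hk'.le,
    mul_inv_cancel₀ hk'.ne', lintegral_add_right_eq_self]
  simp

end

section
open Complex
open scoped ENNReal

lemma integral_norm_pow_four_mul_exp {b : ℝ} (hb : 0 < b) :
    ∫ z : ℂ, ‖z‖ ^ 4 * Real.exp (-b * ‖z‖ ^ 2) = 2 * Real.pi * (b ^ 3)⁻¹ := by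
  have h := Complex.integral_rpow_mul_exp_neg_mul_rpow (p := 2) (q := 4) (by norm_num)
    (by norm_num) hb
  have hG : Real.Gamma 3 = 2 := by
    rw [show (3 : ℝ) = (2 : ℕ) + 1 by norm_num, Real.Gamma_nat_eq_factorial]
    simp
  norm_num [hG] at h
  simp only [neg_mul]
  rw [h]
  ring

lemma lintegral_norm_pow_four_mul_exp {b : ℝ} (hb : 0 < b) :
    ∫⁻ z : ℂ, ENNReal.ofReal (‖z‖ ^ 4 * Real.exp (-b * ‖z‖ ^ 2)) =
      ENNReal.ofReal (2 * Real.pi * (b ^ 3)⁻¹) := by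
  have h := integral_norm_pow_four_mul_exp hb
  rw [← h, ofReal_integral_eq_lintegral_ofReal]
  · refine Integrable.of_integral_ne_zero ?_
    rw [h]
    positivity
  · exact ae_of_all _ fun z => by positivity

/-- The law of the ratio of two correlated complex Gaussians, weighted by the squared modulus of
the denominator. -/
lemma lintegral_lintegral_indicator_complexStdGaussian {σ τ lam : ℝ} (hτ : 0 < τ)
    (hστ : σ ^ 2 + τ ^ 2 = 1) :
    ∫⁻ a, ∫⁻ c, {p : ℂ × ℂ | ‖σ * p.1 + τ * p.2‖ ≤ lam * ‖p.1‖}.indicator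
        (fun p => ENNReal.ofReal (‖p.1‖ ^ 2)) (a, c) ∂complexStdGaussian ∂complexStdGaussian =
      ∫⁻ z in Metric.closedBall (0 : ℂ) lam,
        ENNReal.ofReal (2 / Real.pi * τ ^ 4 * ((1 + ‖z‖ ^ 2 - 2 * σ * z.re) ^ 3)⁻¹) := by
  have hS : MeasurableSet {p : ℂ × ℂ | ‖σ * p.1 + τ * p.2‖ ≤ lam * ‖p.1‖} :=
    measurableSet_le (by fun_prop) (by fun_prop)
  have hF : Measurable ({p : ℂ × ℂ | ‖σ * p.1 + τ * p.2‖ ≤ lam * ‖p.1‖}.indicator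
        (fun p => ENNReal.ofReal (‖p.1‖ ^ 2))) := Measurable.indicator (by fun_prop) hS
  have hFa : ∀ a : ℂ, Measurable fun c =>
      {p : ℂ × ℂ | ‖σ * p.1 + τ * p.2‖ ≤ lam * ‖p.1‖}.indicator
        (fun p => ENNReal.ofReal (‖p.1‖ ^ 2)) (a, c) := fun a => hF.comp (by fun_prop)
  rw [lintegral_complexStdGaussian hF.lintegral_prod_right']
  have hden : ∀ z : ℂ, 0 < 1 + ‖z‖ ^ 2 - 2 * σ * z.re := by
    intro z
    rw [← normSq_eq_norm_sq, normSq_apply]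
    nlinarith [sq_nonneg (z.re - σ), mul_self_nonneg z.im, pow_pos hτ 2]
  have inner : ∀ a : ℂ, a ≠ 0 → ENNReal.ofReal (Real.pi⁻¹ * Real.exp (-‖a‖ ^ 2)) *
      ∫⁻ c, {p : ℂ × ℂ | ‖σ * p.1 + τ * p.2‖ ≤ lam * ‖p.1‖}.indicator
        (fun p => ENNReal.ofReal (‖p.1‖ ^ 2)) (a, c) ∂complexStdGaussian =
      ∫⁻ z, (Metric.closedBall (0 : ℂ) lam).indicator (fun z => ENNReal.ofReal
        (Real.pi⁻¹ ^ 2 * (τ ^ 2)⁻¹ * (‖a‖ ^ 4 *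
          Real.exp (-((1 + ‖z‖ ^ 2 - 2 * σ * z.re) / τ ^ 2) * ‖a‖ ^ 2)))) z := by
    intro a ha
    have hτ' : (τ : ℂ) ≠ 0 := by exact_mod_cast hτ.ne'
    have hm : Measurable fun z : ℂ => ENNReal.ofReal (Real.pi⁻¹ * Real.exp (-‖z‖ ^ 2)) := by
      fun_prop
    rw [lintegral_complexStdGaussian (hFa a)]
    rw [lintegral_mul_add_complex (div_ne_zero ha hτ') (-(σ * a / τ))
        (f := fun z => ENNReal.ofReal (Real.pi⁻¹ * Real.exp (-‖z‖ ^ 2)) * _) (hm.mul (hFa a)), ← mul_assoc,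
      ← ENNReal.ofReal_mul (by positivity), ← lintegral_const_mul' _ _ ENNReal.ofReal_ne_top]
    refine lintegral_congr fun z => ?_
    have e : (σ : ℂ) * a + τ * (a / τ * z + -(σ * a / τ)) = a * z := by
      field_simp
      ring
    have hiff : ‖(σ : ℂ) * a + τ * (a / τ * z + -(σ * a / τ))‖ ≤ lam * ‖a‖ ↔ ‖z‖ ≤ lam := by
      rw [e, norm_mul, mul_comm]
      exact mul_le_mul_iff_left₀ (norm_pos_iff.2 ha)
    by_cases hz : ‖z‖ ≤ lam
    · rw [Set.indicator_of_mem (by exact hiff.2 hz), Set.indicator_of_mem (by simpa using hz),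
        ← ENNReal.ofReal_mul (by positivity), ← ENNReal.ofReal_mul (by positivity)]
      congr 1
      have hn : ‖a / τ * z + -(σ * a / τ)‖ ^ 2 =
          ‖a‖ ^ 2 * (1 + ‖z‖ ^ 2 - 2 * σ * z.re - τ ^ 2) / τ ^ 2 := by
        have : a / τ * z + -(σ * a / τ) = a / τ * (z - σ) := by ring
        rw [this, norm_mul, norm_div, mul_pow, div_pow, norm_real, Real.norm_eq_abs, sq_abs,
          ← normSq_eq_norm_sq (z - σ), ← normSq_eq_norm_sq z, normSq_apply, normSq_apply,
          show 1 = σ ^ 2 + τ ^ 2 from hστ.symm]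
        simp
        ring
      have hexp : Real.exp (-‖a‖ ^ 2) * Real.exp (-‖a / τ * z + -(σ * a / τ)‖ ^ 2) =
          Real.exp (-((1 + ‖z‖ ^ 2 - 2 * σ * z.re) / τ ^ 2) * ‖a‖ ^ 2) := by
        rw [← Real.exp_add, hn]
        congr 1
        field_simp
        ring
      rw [← hexp, norm_div, div_pow, norm_real, Real.norm_eq_abs, sq_abs]
      ring
    · rw [Set.indicator_of_notMem (by exact fun h => hz (hiff.1 h)),
        Set.indicator_of_notMem (by simpa using hz), mul_zero, mul_zero]
  have hae : ∀ᵐ a : ℂ, a ≠ 0 := by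
    simp [ae_iff]
  rw [lintegral_congr_ae (hae.mono inner), lintegral_lintegral_swap,
    ← lintegral_indicator Metric.isClosed_closedBall.measurableSet]
  · refine lintegral_congr fun z => ?_
    by_cases hz : z ∈ Metric.closedBall (0 : ℂ) lam
    · simp only [Set.indicator_of_mem hz]
      have hb : 0 < (1 + ‖z‖ ^ 2 - 2 * σ * z.re) / τ ^ 2 := div_pos (hden z) (pow_pos hτ 2)
      have hc : 0 ≤ Real.pi⁻¹ ^ 2 * (τ ^ 2)⁻¹ := by positivity
      simp_rw [ENNReal.ofReal_mul hc]
      rw [lintegral_const_mul' _ _ ENNReal.ofReal_ne_top, lintegral_norm_pow_four_mul_exp hb,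
        ← ENNReal.ofReal_mul hc]
      congr 1
      have := (hden z).ne'
      field_simp
    · simp [Set.indicator_of_notMem hz]
  · have hB : MeasurableSet {p : ℂ × ℂ | p.2 ∈ Metric.closedBall (0 : ℂ) lam} :=
      measurable_snd Metric.isClosed_closedBall.measurableSet
    have : Measurable ({p : ℂ × ℂ | p.2 ∈ Metric.closedBall (0 : ℂ) lam}.indicator
      (fun p => ENNReal.ofReal
        (Real.pi⁻¹ ^ 2 * (τ ^ 2)⁻¹ * (‖p.1‖ ^ 4 *
          Real.exp (-((1 + ‖p.2‖ ^ 2 - 2 * σ * p.2.re) / τ ^ 2) * ‖p.1‖ ^ 2))))) :=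
      Measurable.indicator (by fun_prop) hB
    exact this.aemeasurable

lemma setLIntegral_closedBall_rotate (lam : ℝ) {u : ℂ} (hu : ‖u‖ = 1) {f : ℂ → ℝ≥0∞} :
    ∫⁻ z in Metric.closedBall (0 : ℂ) lam, f (u * z) =
      ∫⁻ z in Metric.closedBall (0 : ℂ) lam, f z := by
  let c : Circle := ⟨u, mem_sphere_zero_iff_norm.2 hu⟩
  have h := (rotation c).measurePreserving
  have hpre : rotation c ⁻¹' Metric.closedBall (0 : ℂ) lam = Metric.closedBall (0 : ℂ) lam := by
    ext z
    rw [Set.mem_preimage, mem_closedBall_zero_iff, mem_closedBall_zero_iff,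
      LinearIsometryEquiv.norm_map]
  have := h.setLIntegral_comp_preimage_emb
    (rotation c).toHomeomorph.measurableEmbedding f (Metric.closedBall (0 : ℂ) lam)
  rw [hpre] at this
  exact this

lemma integral_closedBall_inv_one_add_sq {lam : ℝ} (hlam : 0 ≤ lam) :
    ∫ z in Metric.closedBall (0 : ℂ) lam, 2 / Real.pi * ((1 + ‖z‖ ^ 2) ^ 3)⁻¹ =
      lam ^ 2 * (lam ^ 2 + 2) / (lam ^ 2 + 1) ^ 2 := by
  have e : ∀ z : ℂ, (Metric.closedBall (0 : ℂ) lam).indicator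
      (fun z => 2 / Real.pi * ((1 + ‖z‖ ^ 2) ^ 3)⁻¹) z =
      (Set.Iic lam).indicator (fun r : ℝ => 2 / Real.pi * ((1 + r ^ 2) ^ 3)⁻¹) ‖z‖ := by
    intro z
    simp [Set.indicator]
  rw [← integral_indicator Metric.isClosed_closedBall.measurableSet]
  simp_rw [e]
  rw [integral_fun_norm_addHaar]
  have e2 : ∀ y : ℝ, y ^ (Module.finrank ℝ ℂ - 1) •
      (Set.Iic lam).indicator (fun r : ℝ => 2 / Real.pi * ((1 + r ^ 2) ^ 3)⁻¹) y =
      (Set.Iic lam).indicator (fun r : ℝ => r * (2 / Real.pi * ((1 + r ^ 2) ^ 3)⁻¹)) y := by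
    intro y
    simp [Set.indicator]
  simp_rw [e2]
  rw [setIntegral_indicator measurableSet_Iic, Set.Ioi_inter_Iic,
    ← intervalIntegral.integral_of_le hlam]
  have e3 := intervalIntegral.integral_eq_sub_of_hasDerivAt (a := 0) (b := lam)
    (f := fun r : ℝ => -(2 * Real.pi)⁻¹ * ((1 + r ^ 2) ^ 2)⁻¹)
    (f' := fun r : ℝ => r * (2 / Real.pi * ((1 + r ^ 2) ^ 3)⁻¹)) (fun r _ => by
      have hr : 1 + r ^ 2 ≠ 0 := by positivity
      have h1 : HasDerivAt (fun r : ℝ => (1 + r ^ 2) ^ 2) (2 * (1 + r ^ 2) * (2 * r)) r := by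
        have := (((hasDerivAt_id r).pow 2).const_add 1).pow 2
        convert! this using 1
        simp
      convert! (h1.inv (pow_ne_zero 2 hr)).const_mul (-(2 * Real.pi)⁻¹) using 1
      field_simp) (by
      apply Continuous.intervalIntegrable
      have : ∀ r : ℝ, (1 + r ^ 2) ^ 3 ≠ 0 := fun r => by positivity
      fun_prop (disch := assumption))
  rw [e3]
  have hv : (volume : Measure ℂ).real (Metric.ball 0 1) = Real.pi := by
    simp [Measure.real]
  rw [hv]
  have : 1 + lam ^ 2 ≠ 0 := by positivity
  have : lam ^ 2 + 1 ≠ 0 := by positivity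
  simp
  field_simp
  ring

lemma setLIntegral_closedBall_le {σ τ lam : ℝ} (hτ : 0 < τ) (hστ : σ ^ 2 + τ ^ 2 = 1)
    (hlam : 0 ≤ lam) (hlam2 : ∀ r, 0 ≤ r → r ≤ lam ^ 2 → 7 * r ≤ (1 + r) ^ 2) :
    ∫⁻ z in Metric.closedBall (0 : ℂ) lam,
        ENNReal.ofReal (2 / Real.pi * τ ^ 4 * ((1 + ‖z‖ ^ 2 - 2 * σ * z.re) ^ 3)⁻¹) ≤
      ENNReal.ofReal (lam ^ 2 * (lam ^ 2 + 2) / (lam ^ 2 + 1) ^ 2) := by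
  have hden : ∀ z : ℂ, 0 < 1 + ‖z‖ ^ 2 - 2 * σ * z.re := by
    intro z
    rw [← normSq_eq_norm_sq, normSq_apply]
    nlinarith [sq_nonneg (z.re - σ), mul_self_nonneg z.im, pow_pos hτ 2]
  obtain ⟨φ, hφ⟩ : ∃ φ : ℂ → ℝ, φ = fun z => 2 / Real.pi * τ ^ 4 *
    ((1 + ‖z‖ ^ 2 - 2 * σ * z.re) ^ 3)⁻¹ := ⟨_, rfl⟩
  have hφ0 : ∀ z, 0 ≤ φ z := by
    intro z
    have := hden z
    rw [hφ]
    positivity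
  have hφm : Measurable fun z => ENNReal.ofReal (φ z) := by
    rw [hφ]
    fun_prop
  have pt : ∀ z ∈ Metric.closedBall (0 : ℂ) lam,
      φ z + φ (-1 * z) + φ (I * z) + φ (-I * z) ≤ 4 * (2 / Real.pi * ((1 + ‖z‖ ^ 2) ^ 3)⁻¹) := by
    intro z hz
    have hz' : ‖z‖ ≤ lam := by simpa using hz
    have hn : ‖z‖ ^ 2 = z.re ^ 2 + z.im ^ 2 := by
      rw [← normSq_eq_norm_sq, normSq_apply]
      ring
    have h := sum_rotations_le (σ := σ) (p := z.re) (q := z.im) (by nlinarith)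
      (by rw [← hn]; exact hlam2 _ (by positivity) (by gcongr))
    rw [← hn, show 1 - σ ^ 2 = τ ^ 2 by linarith] at h
    have h' := mul_le_mul_of_nonneg_left h (by positivity : 0 ≤ 2 / Real.pi)
    rw [hφ]
    simp only [norm_mul, norm_neg, norm_I, one_mul, neg_mul, neg_re, mul_re, I_re, I_im,
      zero_mul, zero_sub, neg_neg, mul_neg, sub_neg_eq_add]
    linarith
  have hrot := fun u hu => setLIntegral_closedBall_rotate lam (u := u) hu
    (f := fun z => ENNReal.ofReal (φ z))
  have hsum : 4 * ∫⁻ z in Metric.closedBall (0 : ℂ) lam, ENNReal.ofReal (φ z) ≤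
      4 * ∫⁻ z in Metric.closedBall (0 : ℂ) lam,
        ENNReal.ofReal (2 / Real.pi * ((1 + ‖z‖ ^ 2) ^ 3)⁻¹) := by
    have e : 4 * ∫⁻ z in Metric.closedBall (0 : ℂ) lam, ENNReal.ofReal (φ z) =
        ∫⁻ z in Metric.closedBall (0 : ℂ) lam,
          ENNReal.ofReal (φ z + φ (-1 * z) + φ (I * z) + φ (-I * z)) := by
      have e' : ∀ z, ENNReal.ofReal (φ z + φ (-1 * z) + φ (I * z) + φ (-I * z)) =
          ENNReal.ofReal (φ z) + ENNReal.ofReal (φ (-1 * z)) + ENNReal.ofReal (φ (I * z)) +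
            ENNReal.ofReal (φ (-I * z)) := by
        intro z
        rw [ENNReal.ofReal_add, ENNReal.ofReal_add, ENNReal.ofReal_add] <;>
          first
          | exact hφ0 _
          | (have := hφ0 z; have := hφ0 (-1 * z); have := hφ0 (I * z); positivity)
      simp_rw [e']
      have hmu : ∀ u : ℂ, Measurable fun z => ENNReal.ofReal (φ (u * z)) :=
        fun u => hφm.comp (by fun_prop)
      rw [lintegral_add_right _ (hmu _), lintegral_add_right _ (hmu _),
        lintegral_add_right _ (hmu _), hrot _ (by simp), hrot _ (by simp), hrot _ (by simp)]
      ring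
    rw [e, ← lintegral_const_mul' _ _ (by simp)]
    refine setLIntegral_mono' Metric.isClosed_closedBall.measurableSet fun z hz => ?_
    rw [show (4 : ℝ≥0∞) = ENNReal.ofReal 4 by simp, ← ENNReal.ofReal_mul (by norm_num)]
    exact ENNReal.ofReal_le_ofReal (pt z hz)
  have hle := (ENNReal.mul_le_mul_iff_right (by simp) (by simp)).1 hsum
  rw [hφ] at hle
  refine hle.trans (le_of_eq ?_)
  rw [← integral_closedBall_inv_one_add_sq hlam, ofReal_integral_eq_lintegral_ofReal]
  · apply ContinuousOn.integrableOn_compact (isCompact_closedBall 0 lam)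
    have : ∀ z : ℂ, (1 + ‖z‖ ^ 2) ^ 3 ≠ 0 := fun z => by positivity
    apply Continuous.continuousOn
    fun_prop (disch := assumption)
  · exact ae_of_all _ fun z => by positivity

end

section
open Complex
open scoped ComplexConjugate ENNReal

lemma setLIntegral_complexStdGaussianVec_eq {n : ℕ} {x h : Fin n → ℂ} {σ τ lam : ℝ}
    (hx : ∑ j, ‖x j‖ ^ 2 = 1) (hh : ∑ j, ‖h j‖ ^ 2 = 1) (hσ : ∑ j, conj (h j) * x j = σ)
    (hτ : 0 < τ) (hστ : σ ^ 2 + τ ^ 2 = 1) :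
    ∫⁻ ξ in {ξ : Fin n → ℂ | ‖∑ j, conj (ξ j) * x j‖ ≤ lam * ‖∑ j, conj (ξ j) * h j‖},
        ENNReal.ofReal (‖∑ j, conj (ξ j) * h j‖ ^ 2) ∂complexStdGaussianVec n =
      ∫⁻ a, ∫⁻ c, {p : ℂ × ℂ | ‖σ * p.1 + τ * p.2‖ ≤ lam * ‖p.1‖}.indicator
        (fun p => ENNReal.ofReal (‖p.1‖ ^ 2)) (a, c) ∂complexStdGaussian ∂complexStdGaussian := by
  have hτ' : (τ : ℂ) ≠ 0 := by exact_mod_cast hτ.ne'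
  have hhC : ∑ j, conj (h j) * h j = 1 := by
    simp_rw [conj_mul']
    exact_mod_cast hh
  obtain ⟨y, hy⟩ : ∃ y : Fin n → ℂ, ∀ j, y j = (x j - σ * h j) / τ := ⟨_, fun j => rfl⟩
  have hhy : ∑ j, conj (h j) * y j = 0 := by
    have e : ∀ j, conj (h j) * y j = (conj (h j) * x j - σ * (conj (h j) * h j)) / τ := by
      intro j
      rw [hy]
      ring
    simp_rw [e]
    rw [← Finset.sum_div, Finset.sum_sub_distrib, ← Finset.mul_sum, hσ, hhC]
    simp
  have hyn : ∑ j, ‖y j‖ ^ 2 = 1 := by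
    have e : ∀ j, ‖y j‖ ^ 2 =
        (‖x j‖ ^ 2 + σ ^ 2 * ‖h j‖ ^ 2 - 2 * σ * (conj (h j) * x j).re) / τ ^ 2 := by
      intro j
      rw [hy, norm_div, div_pow, norm_real, Real.norm_eq_abs, sq_abs]
      simp only [← normSq_eq_norm_sq, normSq_apply]
      simp
      ring
    simp_rw [e]
    rw [← Finset.sum_div, Finset.sum_sub_distrib, Finset.sum_add_distrib, ← Finset.mul_sum,
      ← Finset.mul_sum, ← re_sum, hx, hh, hσ, ofReal_re, div_eq_one_iff_eq (by positivity)]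
    linarith
  have hS : MeasurableSet {p : ℂ × ℂ | ‖σ * p.1 + τ * p.2‖ ≤ lam * ‖p.1‖} :=
    measurableSet_le (by fun_prop) (by fun_prop)
  have hF : Measurable ({p : ℂ × ℂ | ‖σ * p.1 + τ * p.2‖ ≤ lam * ‖p.1‖}.indicator
        (fun p => ENNReal.ofReal (‖p.1‖ ^ 2))) := Measurable.indicator (by fun_prop) hS
  have hm : Measurable fun ξ : Fin n → ℂ => (∑ j, conj (ξ j) * h j, ∑ j, conj (ξ j) * y j) := by
    have : Continuous fun ξ : Fin n → ℂ => (∑ j, conj (ξ j) * h j, ∑ j, conj (ξ j) * y j) := by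
      fun_prop
    exact this.measurable
  rw [← lintegral_prod _ hF.aemeasurable, ← complexStdGaussianVec_map_prod hh hyn hhy,
    lintegral_map hF hm, ← lintegral_indicator]
  · refine lintegral_congr fun ξ => ?_
    have e : ∑ j, conj (ξ j) * x j =
        σ * ∑ j, conj (ξ j) * h j + τ * ∑ j, conj (ξ j) * y j := by
      rw [Finset.mul_sum, Finset.mul_sum, ← Finset.sum_add_distrib]
      refine Finset.sum_congr rfl fun j _ => ?_
      rw [hy]
      field_simp
      ring
    simp only [Set.indicator, Set.mem_ofPred_eq, e]
  · have h1 : Continuous fun ξ : Fin n → ℂ => ∑ j, conj (ξ j) * x j := by fun_prop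
    have h2 : Continuous fun ξ : Fin n → ℂ => ∑ j, conj (ξ j) * h j := by fun_prop
    exact measurableSet_le h1.norm.measurable (h2.norm.measurable.const_mul lam)

end

theorem stmt_15 (n : ℕ) (x h : Fin n → ℂ)
    (hx : ∑ j, ‖x j‖^2 = 1) (hh : ∑ j, ‖h j‖^2 = 1)
    (him : (∑ j, (starRingEnd ℂ) (h j) * x j).im = 0)
    (lam : ℝ) (hlam : 0 < lam) (hlam2 : lam ≤ Real.sqrt ((5 - Real.sqrt 21)/2)) :
    (∫ ξ in {ξ : Fin n → ℂ |
        ‖∑ j, (starRingEnd ℂ) (ξ j) * x j‖ ≤ lam * ‖∑ j, (starRingEnd ℂ) (ξ j) * h j‖},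
        ‖∑ j, (starRingEnd ℂ) (ξ j) * h j‖^2 ∂(complexStdGaussianVec n))
      ≤ lam^2*(lam^2+2)/(lam^2+1)^2 ∧
    lam^2*(lam^2+2)/(lam^2+1)^2 ≤ 2*lam^2/(lam^2+1) := by
  have h21 : Real.sqrt 21 ^ 2 = 21 := Real.sq_sqrt (by norm_num)
  have h4 : 4 < Real.sqrt 21 := Real.lt_sqrt_of_sq_lt (by norm_num)
  have h5 : Real.sqrt 21 < 5 := (Real.sqrt_lt' (by norm_num)).2 (by norm_num)
  have hl2 : lam ^ 2 ≤ (5 - Real.sqrt 21) / 2 :=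
    (Real.le_sqrt hlam.le (by linarith)).1 hlam2
  have hr : ∀ r, 0 ≤ r → r ≤ lam ^ 2 → 7 * r ≤ (1 + r) ^ 2 := by
    intro r _ hr
    nlinarith
  refine ⟨?_, ?_⟩
  · obtain ⟨σ, hσ⟩ : ∃ σ : ℝ, ∑ j, (starRingEnd ℂ) (h j) * x j = σ :=
      ⟨(∑ j, (starRingEnd ℂ) (h j) * x j).re, Complex.ext (by simp) (by simpa using him)⟩
    have hnn : 0 ≤ lam ^ 2 * (lam ^ 2 + 2) / (lam ^ 2 + 1) ^ 2 := by positivity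
    have hdiff : ∑ j, ‖x j - σ * h j‖ ^ 2 = 1 - σ ^ 2 := by
      have e : ∀ j, ‖x j - σ * h j‖ ^ 2 =
          ‖x j‖ ^ 2 + σ ^ 2 * ‖h j‖ ^ 2 - 2 * σ * ((starRingEnd ℂ) (h j) * x j).re := by
        intro j
        simp only [← Complex.normSq_eq_norm_sq, Complex.normSq_apply]
        simp
        ring
      simp_rw [e]
      rw [Finset.sum_sub_distrib, Finset.sum_add_distrib, ← Finset.mul_sum, ← Finset.mul_sum,
        ← Complex.re_sum, hx, hh, hσ, Complex.ofReal_re]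
      ring
    have hσ1 : 0 ≤ 1 - σ ^ 2 := hdiff ▸ Finset.sum_nonneg fun j _ => sq_nonneg _
    have hcont : ∀ v : Fin n → ℂ,
        Continuous fun ξ : Fin n → ℂ => ∑ j, (starRingEnd ℂ) (ξ j) * v j := by
      intro v
      fun_prop
    rcases hσ1.eq_or_lt with h0 | hpos
    · have hxj : ∀ j, x j = σ * h j := by
        intro j
        rw [← h0] at hdiff
        have := (Finset.sum_eq_zero_iff_of_nonneg fun j _ => sq_nonneg _).1 hdiff j
          (Finset.mem_univ j)
        exact sub_eq_zero.1 (norm_eq_zero.1 (pow_eq_zero_iff two_ne_zero |>.1 this))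
      have hzero : ∀ ξ ∈ {ξ : Fin n → ℂ | ‖∑ j, (starRingEnd ℂ) (ξ j) * x j‖ ≤
          lam * ‖∑ j, (starRingEnd ℂ) (ξ j) * h j‖},
          ‖∑ j, (starRingEnd ℂ) (ξ j) * h j‖ ^ 2 = 0 := by
        intro ξ hξ
        have e : ∑ j, (starRingEnd ℂ) (ξ j) * x j = σ * ∑ j, (starRingEnd ℂ) (ξ j) * h j := by
          rw [Finset.mul_sum]
          refine Finset.sum_congr rfl fun j _ => ?_
          rw [hxj]
          ring
        have hs : |σ| = 1 := by
          rw [← sq_eq_sq₀ (abs_nonneg σ) zero_le_one, sq_abs]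
          linarith
        rw [Set.mem_ofPred_eq, e, norm_mul, Complex.norm_real, Real.norm_eq_abs, hs, one_mul] at hξ
        have hl1 : lam < 1 := by nlinarith
        have : ‖∑ j, (starRingEnd ℂ) (ξ j) * h j‖ = 0 := by
          nlinarith [norm_nonneg (∑ j, (starRingEnd ℂ) (ξ j) * h j)]
        rw [this]
        norm_num
      rw [setIntegral_congr_fun (measurableSet_le (hcont x).norm.measurable
        ((hcont h).norm.measurable.const_mul lam)) hzero]
      simpa using hnn
    · have hτ : 0 < Real.sqrt (1 - σ ^ 2) := Real.sqrt_pos.2 hpos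
      have hστ : σ ^ 2 + Real.sqrt (1 - σ ^ 2) ^ 2 = 1 := by
        rw [Real.sq_sqrt hσ1]
        ring
      have hc : Continuous fun ξ : Fin n → ℂ => ‖∑ j, (starRingEnd ℂ) (ξ j) * h j‖ ^ 2 :=
        (hcont h).norm.pow 2
      rw [integral_eq_lintegral_of_nonneg_ae (ae_of_all _ fun ξ => sq_nonneg _)
        hc.aestronglyMeasurable]
      refine ENNReal.toReal_le_of_le_ofReal hnn ?_
      rw [setLIntegral_complexStdGaussianVec_eq hx hh hσ hτ hστ,
        lintegral_lintegral_indicator_complexStdGaussian hτ hστ]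
      exact setLIntegral_closedBall_le hτ hστ hlam.le hr
  · rw [div_le_div_iff₀ (by positivity) (by positivity)]
    nlinarith [pow_pos hlam 2, pow_pos hlam 4, pow_pos hlam 6]
end

section
/- Let ξ ∈ ℂⁿ be a standard complex Gaussian vector and x, h unit vectors in ℂⁿ with Im(h*x) = 0. For λ ≥ 2.95, E[Re²(h* ξ ξ* x)/|ξ*x|² · 1{λ|ξ*x| ≥ |ξ*h|}] ≥ 3/8 − 1/(λ+1)². -/
open MeasureTheory ProbabilityTheory

open Complex in
lemma complexStdGaussian_eq_map_equivRealProdCLM :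
    complexStdGaussian = ((gaussianReal 0 (1 / 2)).prod (gaussianReal 0 (1 / 2))).map
      (equivRealProdCLM.symm : ℝ × ℝ →L[ℝ] ℂ) := by
  unfold complexStdGaussian
  congr 1
  ext p
  simp [Complex.equivRealProdCLM_symm_apply]

instance inst_s16 : IsProbabilityMeasure complexStdGaussian := by
  rw [complexStdGaussian_eq_map_equivRealProdCLM]
  exact Measure.isProbabilityMeasure_map (by fun_prop)

instance inst_s16_2 (n : ℕ) : IsProbabilityMeasure (complexStdGaussianVec n) := by
  unfold complexStdGaussianVec
  infer_instance

lemma charFunDual_gaussianReal_half (L : StrongDual ℝ ℝ) :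
    charFunDual (gaussianReal 0 (1 / 2)) L = Complex.exp (((-(L 1) ^ 2 / 4 : ℝ)) : ℂ) := by
  have h : charFunDual (gaussianReal 0 (1 / 2)) L = charFun (gaussianReal 0 (1 / 2)) (L 1) := by
    rw [charFunDual_apply, charFun_apply_real]
    congr with x
    have : L x = L 1 * x := by
      conv_lhs => rw [← mul_one x, ← smul_eq_mul, map_smul, smul_eq_mul, mul_comm]
    rw [this]
    push_cast
    rfl
  rw [h, charFun_gaussianReal]
  congr 1
  push_cast
  ring

lemma charFunDual_complexStdGaussian (L : StrongDual ℝ ℂ) :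
    charFunDual complexStdGaussian L =
      Complex.exp (((-((L 1) ^ 2 + (L Complex.I) ^ 2) / 4 : ℝ)) : ℂ) := by
  rw [complexStdGaussian_eq_map_equivRealProdCLM, charFunDual_map, charFunDual_prod,
    charFunDual_gaussianReal_half, charFunDual_gaussianReal_half, ← Complex.exp_add]
  congr 1
  rw [← Complex.ofReal_add]
  congr 1
  simp [Complex.equivRealProdCLM_symm_apply]
  ring

lemma charFunDual_complexStdGaussianVec {n : ℕ} (L : StrongDual ℝ (Fin n → ℂ)) :
    charFunDual (complexStdGaussianVec n) L =
      Complex.exp (((-(∑ j, ((L (Pi.single j 1)) ^ 2 + (L (Pi.single j Complex.I)) ^ 2)) / 4 : ℝ)) :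
        ℂ) := by
  unfold complexStdGaussianVec
  rw [charFunDual_pi]
  simp_rw [charFunDual_complexStdGaussian]
  rw [← Complex.exp_sum, ← Complex.ofReal_sum]
  congr 2
  rw [← Finset.sum_div, ← Finset.sum_neg_distrib]
  simp

/-- The pairing `ξ ↦ ξ* x` as a real-linear map. -/
noncomputable def conjPairing {n : ℕ} (x : Fin n → ℂ) : (Fin n → ℂ) →L[ℝ] ℂ :=
  ∑ j, (ContinuousLinearMap.mul ℝ ℂ (x j)).comp
    (Complex.conjCLE.toContinuousLinearMap.comp (ContinuousLinearMap.proj j))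

lemma conjPairing_apply {n : ℕ} (x ξ : Fin n → ℂ) :
    conjPairing x ξ = ∑ j, (starRingEnd ℂ) (ξ j) * x j := by
  simp [conjPairing, mul_comm]

lemma conjPairing_single {n : ℕ} (x : Fin n → ℂ) (j : Fin n) (a : ℂ) :
    conjPairing x (Pi.single j a) = (starRingEnd ℂ) a * x j := by
  rw [conjPairing_apply, Finset.sum_eq_single j] <;> simp +contextual

/-- The linear map sending a pair of independent standard Gaussians to a pair with
correlation `σ`. -/
noncomputable def correlate (σ τ : ℝ) : ℂ × ℂ →L[ℝ] ℂ × ℂ :=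
  (ContinuousLinearMap.fst ℝ ℂ ℂ).prod
    (σ • ContinuousLinearMap.fst ℝ ℂ ℂ + τ • ContinuousLinearMap.snd ℝ ℂ ℂ)

lemma correlate_apply (σ τ : ℝ) (p : ℂ × ℂ) :
    correlate σ τ p = (p.1, σ * p.1 + τ * p.2) := by
  simp [correlate]

lemma map_conjPairing_prod {n : ℕ} {x h : Fin n → ℂ} {σ τ : ℝ}
    (hx : ∑ j, ‖x j‖ ^ 2 = 1) (hh : ∑ j, ‖h j‖ ^ 2 = 1)
    (hσ : ∑ j, (starRingEnd ℂ) (h j) * x j = σ) (hτ : σ ^ 2 + τ ^ 2 = 1) :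
    (complexStdGaussianVec n).map ((conjPairing x).prod (conjPairing h)) =
      (complexStdGaussian.prod complexStdGaussian).map (correlate σ τ) := by
  apply Measure.ext_of_charFunDual
  ext M
  rw [charFunDual_map, charFunDual_map, charFunDual_complexStdGaussianVec, charFunDual_prod,
    charFunDual_complexStdGaussian, charFunDual_complexStdGaussian, ← Complex.exp_add,
    ← Complex.ofReal_add]
  congr 2
  have hM (a b : ℂ) : M (a, b) = a.re * M (1, 0) + a.im * M (Complex.I, 0) +
      b.re * M (0, 1) + b.im * M (0, Complex.I) := by
    have : (a, b) = a.re • ((1 : ℂ), (0 : ℂ)) + a.im • (Complex.I, (0 : ℂ)) +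
        b.re • ((0 : ℂ), (1 : ℂ)) + b.im • ((0 : ℂ), Complex.I) := by
      ext <;> simp
    rw [this]
    simp only [map_add, map_smul, smul_eq_mul]
  simp only [ContinuousLinearMap.comp_apply, ContinuousLinearMap.prod_apply, conjPairing_single,
    ContinuousLinearMap.inl_apply, ContinuousLinearMap.inr_apply, correlate_apply]
  generalize M (1, 0) = m₁ at hM
  generalize M (Complex.I, 0) = m₂ at hM
  generalize M (0, 1) = m₃ at hM
  generalize M (0, Complex.I) = m₄ at hM
  simp only [hM]
  have hre := congrArg Complex.re hσ
  have him := congrArg Complex.im hσ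
  simp only [Complex.sq_norm, Complex.normSq_apply] at hx hh
  simp only [Complex.re_sum, Complex.im_sum, Complex.mul_re, Complex.mul_im, Complex.conj_re,
    Complex.conj_im, Complex.ofReal_re, Complex.ofReal_im] at hre him
  have hsum : ∑ j, (((x j).re * m₁ + (x j).im * m₂ + (h j).re * m₃ + (h j).im * m₄) ^ 2 +
      ((x j).im * m₁ + -(x j).re * m₂ + (h j).im * m₃ + -(h j).re * m₄) ^ 2) =
      (m₁ ^ 2 + m₂ ^ 2) + (m₃ ^ 2 + m₄ ^ 2) + 2 * (m₁ * m₃ + m₂ * m₄) * σ := by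
    rw [← mul_one (m₁ ^ 2 + m₂ ^ 2), ← mul_one (m₃ ^ 2 + m₄ ^ 2)]
    conv_rhs => rw [← hre, ← add_zero (_ + _ + _),
      ← mul_zero (2 * (m₂ * m₃ - m₁ * m₄)), ← him, ← hx]
    conv_rhs => enter [1, 1, 2, 2]; rw [hx, ← hh]
    simp only [Finset.mul_sum, ← Finset.sum_add_distrib]
    refine Finset.sum_congr rfl fun j _ => ?_
    ring
  simp at hsum ⊢
  rw [hsum]
  linear_combination (-(m₃ ^ 2 + m₄ ^ 2) / 4) * (-hτ)

lemma integrable_pow_gaussianReal_half (k : ℕ) :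
    Integrable (fun x : ℝ => x ^ k) (gaussianReal 0 (1 / 2)) := by
  have h := (memLp_id_gaussianReal' (μ := 0) (v := 1 / 2) k (by simp)).integrable_norm_pow'
  refine h.mono' (by fun_prop) (Filter.Eventually.of_forall fun x => ?_)
  simp

lemma integral_sq_gaussianReal_half : ∫ x : ℝ, x ^ 2 ∂(gaussianReal 0 (1 / 2)) = 1 / 2 := by
  have h := variance_fun_id_gaussianReal (μ := 0) (v := 1 / 2)
  rw [variance_eq_integral (by fun_prop)] at h
  simpa using h

lemma integral_pow_four_gaussianReal_half :
    ∫ x : ℝ, x ^ 4 ∂(gaussianReal 0 (1 / 2)) = 3 / 4 := by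
  rw [integral_gaussianReal_eq_integral_smul (by norm_num)]
  have hpdf (x : ℝ) : gaussianPDFReal 0 (1 / 2) x • x ^ 4 =
      (fun y : ℝ => (√Real.pi)⁻¹ * (y ^ (4 : ℝ) * Real.exp (-1 * y ^ (2 : ℝ)))) |x| := by
    have h4 : |x| ^ (4 : ℝ) = x ^ 4 := by
      rw [show (4 : ℝ) = ((4 : ℕ) : ℝ) by norm_num, Real.rpow_natCast]
      exact (by decide : Even 4).pow_abs x
    have h2 : |x| ^ (2 : ℝ) = x ^ 2 := by
      rw [show (2 : ℝ) = ((2 : ℕ) : ℝ) by norm_num, Real.rpow_natCast]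
      exact sq_abs x
    simp only [h4, h2, gaussianPDFReal, smul_eq_mul, NNReal.coe_div, NNReal.coe_one,
      NNReal.coe_ofNat]
    rw [show 2 * Real.pi * (1 / 2) = Real.pi by ring,
      show -(x - 0) ^ 2 / (2 * (1 / 2)) = -1 * x ^ 2 by ring]
    ring
  rw [integral_congr_ae (Filter.Eventually.of_forall hpdf),
    integral_comp_abs (f := fun y : ℝ =>
      (√Real.pi)⁻¹ * (y ^ (4 : ℝ) * Real.exp (-1 * y ^ (2 : ℝ)))),
    integral_const_mul,
    integral_rpow_mul_exp_neg_mul_rpow (by norm_num) (by norm_num) (by norm_num),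
    show ((4 : ℝ) + 1) / 2 = (3 / 2) + 1 by norm_num, Real.Gamma_add_one (by norm_num),
    show (3 / 2 : ℝ) = 1 / 2 + 1 by norm_num, Real.Gamma_add_one (by norm_num),
    Real.Gamma_one_half_eq]
  have : √Real.pi ≠ 0 := by positivity
  simp
  field_simp
  norm_num

lemma integral_complexStdGaussian (f : ℂ → ℝ) (hf : Continuous f) :
    ∫ z, f z ∂complexStdGaussian =
      ∫ p : ℝ × ℝ, f (p.1 + p.2 * Complex.I)
        ∂((gaussianReal 0 (1 / 2)).prod (gaussianReal 0 (1 / 2))) := by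
  unfold complexStdGaussian
  rw [integral_map (by fun_prop) hf.aestronglyMeasurable]

lemma integrable_re_pow_mul_im_pow (k l : ℕ) :
    Integrable (fun z : ℂ => z.re ^ k * z.im ^ l) complexStdGaussian := by
  unfold complexStdGaussian
  rw [integrable_map_measure (Continuous.aestronglyMeasurable (by fun_prop)) (by fun_prop)]
  have := (integrable_pow_gaussianReal_half k).mul_prod (integrable_pow_gaussianReal_half l)
  refine this.congr (Filter.Eventually.of_forall fun p => ?_)
  simp

lemma integral_re_pow_mul_im_pow (k l : ℕ) :
    ∫ z : ℂ, z.re ^ k * z.im ^ l ∂complexStdGaussian =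
      (∫ x : ℝ, x ^ k ∂(gaussianReal 0 (1 / 2))) * ∫ x : ℝ, x ^ l ∂(gaussianReal 0 (1 / 2)) := by
  rw [integral_complexStdGaussian _ (by fun_prop), ← integral_prod_mul]
  simp

lemma integrable_norm_sq_complexStdGaussian :
    Integrable (fun z : ℂ => ‖z‖ ^ 2) complexStdGaussian := by
  refine ((integrable_re_pow_mul_im_pow 2 0).add (integrable_re_pow_mul_im_pow 0 2)).congr
    (Filter.Eventually.of_forall fun z => ?_)
  simp only [Pi.add_apply]
  rw [Complex.sq_norm, Complex.normSq_apply]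
  ring

lemma integral_norm_sq_complexStdGaussian : ∫ z : ℂ, ‖z‖ ^ 2 ∂complexStdGaussian = 1 := by
  have h (z : ℂ) : ‖z‖ ^ 2 = z.re ^ 2 * z.im ^ 0 + z.re ^ 0 * z.im ^ 2 := by
    rw [Complex.sq_norm, Complex.normSq_apply]
    ring
  simp_rw [h]
  rw [integral_add (integrable_re_pow_mul_im_pow 2 0) (integrable_re_pow_mul_im_pow 0 2),
    integral_re_pow_mul_im_pow, integral_re_pow_mul_im_pow, integral_sq_gaussianReal_half]
  simp
  norm_num

lemma integrable_norm_pow_four_complexStdGaussian :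
    Integrable (fun z : ℂ => ‖z‖ ^ 4) complexStdGaussian := by
  refine (((integrable_re_pow_mul_im_pow 4 0).add
    ((integrable_re_pow_mul_im_pow 2 2).const_mul 2)).add (integrable_re_pow_mul_im_pow 0 4)).congr
    (Filter.Eventually.of_forall fun z => ?_)
  simp only [Pi.add_apply]
  rw [show ‖z‖ ^ 4 = (‖z‖ ^ 2) ^ 2 by ring, Complex.sq_norm, Complex.normSq_apply]
  ring

lemma integral_norm_pow_four_complexStdGaussian :
    ∫ z : ℂ, ‖z‖ ^ 4 ∂complexStdGaussian = 2 := by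
  have h (z : ℂ) : ‖z‖ ^ 4 =
      (z.re ^ 4 * z.im ^ 0 + 2 * (z.re ^ 2 * z.im ^ 2)) + z.re ^ 0 * z.im ^ 4 := by
    rw [show ‖z‖ ^ 4 = (‖z‖ ^ 2) ^ 2 by ring, Complex.sq_norm, Complex.normSq_apply]
    ring
  have hint : Integrable (fun z : ℂ => z.re ^ 4 * z.im ^ 0 + 2 * (z.re ^ 2 * z.im ^ 2))
      complexStdGaussian :=
    (integrable_re_pow_mul_im_pow 4 0).add ((integrable_re_pow_mul_im_pow 2 2).const_mul 2)
  simp_rw [h]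
  rw [integral_add hint (integrable_re_pow_mul_im_pow 0 4),
    integral_add (integrable_re_pow_mul_im_pow 4 0)
      ((integrable_re_pow_mul_im_pow 2 2).const_mul 2), integral_const_mul]
  simp only [integral_re_pow_mul_im_pow, integral_sq_gaussianReal_half,
    integral_pow_four_gaussianReal_half]
  simp
  norm_num

lemma complexStdGaussian_singleton_zero : complexStdGaussian {0} = 0 := by
  have : NullSingletonClass (gaussianReal 0 (1 / 2)) :=
    nullSingletonClass_gaussianReal (by norm_num)
  unfold complexStdGaussian
  rw [Measure.map_apply (by fun_prop) (by simp)]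
  refine measure_mono_null (t := {(0, 0)}) (fun p hp => ?_) ?_
  · have h1 := congrArg Complex.re hp
    have h2 := congrArg Complex.im hp
    simp at h1 h2
    ext <;> simp [h1, h2]
  · rw [← Set.singleton_prod_singleton, Measure.prod_prod]
    simp only [measure_singleton, mul_zero]

lemma gaussianReal_half_le_smul_volume :
    gaussianReal 0 (1 / 2) ≤ ENNReal.ofReal (√Real.pi)⁻¹ • (volume : Measure ℝ) := by
  rw [gaussianReal_of_var_ne_zero _ (by norm_num), ← withDensity_const]
  refine withDensity_mono (Filter.Eventually.of_forall fun x => ?_)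
  refine ENNReal.ofReal_le_ofReal ?_
  simp only [gaussianPDFReal, NNReal.coe_div, NNReal.coe_one, NNReal.coe_ofNat]
  rw [show 2 * Real.pi * (1 / 2) = Real.pi by ring]
  refine mul_le_of_le_one_right (by positivity) (Real.exp_le_one_iff.2 ?_)
  have := sq_nonneg (x - 0)
  linarith

lemma lintegral_complexStdGaussian_le (F : ℂ → ENNReal) (hF : Measurable F) :
    ∫⁻ z, F z ∂complexStdGaussian ≤ ENNReal.ofReal Real.pi⁻¹ * ∫⁻ z, F z := by
  unfold complexStdGaussian
  rw [lintegral_map hF (by fun_prop), lintegral_prod _ (by fun_prop),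
    ← Complex.volume_preserving_equiv_real_prod.symm.lintegral_comp hF,
    Measure.volume_eq_prod, lintegral_prod _ (by fun_prop)]
  set c := ENNReal.ofReal (√Real.pi)⁻¹ with hc
  have hle (f : ℝ → ENNReal) : ∫⁻ x, f x ∂(gaussianReal 0 (1 / 2)) ≤ c * ∫⁻ x, f x := by
    rw [← smul_eq_mul, ← lintegral_smul_measure]
    exact lintegral_mono' gaussianReal_half_le_smul_volume le_rfl
  have hcc : c * c = ENNReal.ofReal Real.pi⁻¹ := by
    rw [hc, ← ENNReal.ofReal_mul (by positivity), ← mul_inv, Real.mul_self_sqrt Real.pi_pos.le]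
  calc _ ≤ c * ∫⁻ x : ℝ, ∫⁻ y : ℝ, F (x + y * Complex.I) ∂(gaussianReal 0 (1 / 2)) := hle _
    _ ≤ c * ∫⁻ x : ℝ, c * ∫⁻ y : ℝ, F (x + y * Complex.I) := by
        gcongr with x
        exact hle _
    _ = _ := by
        rw [lintegral_const_mul _ (by fun_prop), ← mul_assoc, hcc]
        simp [Complex.measurableEquivRealProd_symm_apply, Complex.mk_eq_add_mul_I]

/-- The squared real part of `b* z / |z|`. -/
noncomputable def sqReProj (z b : ℂ) : ℝ := ((starRingEnd ℂ) b * z).re ^ 2 / ‖z‖ ^ 2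

/-- The part of `sqReProj` lost by truncating to `‖b‖ ≤ lam * ‖z‖`. -/
noncomputable def sqReProjLoss (lam : ℝ) (z b : ℂ) : ℝ :=
  if lam * ‖z‖ < ‖b‖ then sqReProj z b else 0

lemma sqReProj_nonneg (z b : ℂ) : 0 ≤ sqReProj z b := by
  unfold sqReProj
  positivity

lemma sqReProj_le (z b : ℂ) : sqReProj z b ≤ ‖b‖ ^ 2 := by
  unfold sqReProj
  refine div_le_of_le_mul₀ (by positivity) (by positivity) ?_
  rw [← mul_pow, ← sq_abs]
  gcongr
  exact (Complex.abs_re_le_norm _).trans (by simp)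

lemma sqReProjLoss_nonneg (lam : ℝ) (z b : ℂ) : 0 ≤ sqReProjLoss lam z b := by
  unfold sqReProjLoss
  split_ifs
  exacts [sqReProj_nonneg z b, le_rfl]

lemma sqReProjLoss_le (lam : ℝ) (z b : ℂ) : sqReProjLoss lam z b ≤ sqReProj z b := by
  unfold sqReProjLoss
  split_ifs
  exacts [le_rfl, sqReProj_nonneg z b]

@[fun_prop]
lemma measurable_sqReProj : Measurable fun p : ℂ × ℂ => sqReProj p.1 p.2 := by
  unfold sqReProj
  fun_prop

@[fun_prop]
lemma measurable_sqReProjLoss (lam : ℝ) :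
    Measurable fun p : ℂ × ℂ => sqReProjLoss lam p.1 p.2 :=
  Measurable.ite (measurableSet_lt (by fun_prop) (by fun_prop)) (by fun_prop) (by fun_prop)

lemma integral_quadratic_complexStdGaussian (a b c d e k : ℝ) :
    ∫ w : ℂ, (a + b * w.re + c * w.im + d * w.re ^ 2 + e * (w.re * w.im) + k * w.im ^ 2)
      ∂complexStdGaussian = a + (d + k) / 2 := by
  have i1 := (integrable_re_pow_mul_im_pow 1 0).const_mul b
  have i2 := (integrable_re_pow_mul_im_pow 0 1).const_mul c
  have i3 := (integrable_re_pow_mul_im_pow 2 0).const_mul d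
  have i4 := (integrable_re_pow_mul_im_pow 1 1).const_mul e
  have i5 := (integrable_re_pow_mul_im_pow 0 2).const_mul k
  have e1 := integral_re_pow_mul_im_pow 1 0
  have e2 := integral_re_pow_mul_im_pow 0 1
  have e3 := integral_re_pow_mul_im_pow 2 0
  have e4 := integral_re_pow_mul_im_pow 1 1
  have e5 := integral_re_pow_mul_im_pow 0 2
  simp only [pow_one, pow_zero, mul_one, one_mul, integral_id_gaussianReal,
    integral_sq_gaussianReal_half, integral_const, probReal_univ, smul_eq_mul,
    mul_zero] at i1 i2 i3 i4 i5 e1 e2 e3 e4 e5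
  rw [integral_add (by fun_prop) i5, integral_add (by fun_prop) i4,
    integral_add (by fun_prop) i3, integral_add (by fun_prop) i2,
    integral_add (by fun_prop) i1]
  simp only [integral_const_mul, e1, e2, e3, e4, e5, integral_const, probReal_univ, smul_eq_mul]
  ring

lemma integral_sqReProj_affine {z : ℂ} (hz : z ≠ 0) (σ τ : ℝ) :
    ∫ w : ℂ, sqReProj z (σ * z + τ * w) ∂complexStdGaussian = σ ^ 2 * ‖z‖ ^ 2 + τ ^ 2 / 2 := by
  have hN : ‖z‖ ^ 2 ≠ 0 := by positivity
  have h (w : ℂ) : sqReProj z (σ * z + τ * w) =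
      σ ^ 2 * ‖z‖ ^ 2 + 2 * σ * τ * z.re * w.re + 2 * σ * τ * z.im * w.im +
        τ ^ 2 * z.re ^ 2 / ‖z‖ ^ 2 * w.re ^ 2 +
        2 * τ ^ 2 * z.re * z.im / ‖z‖ ^ 2 * (w.re * w.im) +
        τ ^ 2 * z.im ^ 2 / ‖z‖ ^ 2 * w.im ^ 2 := by
    unfold sqReProj
    field_simp
    simp [Complex.sq_norm, Complex.normSq_apply]
    ring
  simp_rw [h]
  rw [integral_quadratic_complexStdGaussian, ← add_div, ← mul_add,
    show z.re ^ 2 + z.im ^ 2 = ‖z‖ ^ 2 by rw [Complex.sq_norm, Complex.normSq_apply]; ring,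
    mul_div_cancel_right₀ _ hN]

lemma integrable_sqReProj_correlate (σ τ : ℝ) :
    Integrable (fun p : ℂ × ℂ => sqReProj p.1 (σ * p.1 + τ * p.2))
      (complexStdGaussian.prod complexStdGaussian) := by
  have h1 : Integrable (fun p : ℂ × ℂ => 2 * σ ^ 2 * ‖p.1‖ ^ 2)
      (complexStdGaussian.prod complexStdGaussian) :=
    (integrable_norm_sq_complexStdGaussian.comp_fst complexStdGaussian).const_mul _
  have h2 : Integrable (fun p : ℂ × ℂ => 2 * τ ^ 2 * ‖p.2‖ ^ 2)
      (complexStdGaussian.prod complexStdGaussian) :=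
    (integrable_norm_sq_complexStdGaussian.comp_snd complexStdGaussian).const_mul _
  have hmeas : Measurable fun p : ℂ × ℂ => sqReProj p.1 (σ * p.1 + τ * p.2) := by
    fun_prop
  refine (h1.add h2).mono' hmeas.aestronglyMeasurable (Filter.Eventually.of_forall fun p => ?_)
  rw [Real.norm_of_nonneg (sqReProj_nonneg _ _)]
  refine (sqReProj_le _ _).trans ?_
  calc ‖(σ : ℂ) * p.1 + τ * p.2‖ ^ 2 ≤ (‖(σ : ℂ) * p.1‖ + ‖(τ : ℂ) * p.2‖) ^ 2 := by
        gcongr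
        exact norm_add_le _ _
    _ ≤ 2 * (‖(σ : ℂ) * p.1‖ ^ 2 + ‖(τ : ℂ) * p.2‖ ^ 2) := add_sq_le
    _ = 2 * σ ^ 2 * ‖p.1‖ ^ 2 + 2 * τ ^ 2 * ‖p.2‖ ^ 2 := by
        simp only [norm_mul, Complex.norm_real, mul_pow, Real.norm_eq_abs, sq_abs]
        ring

lemma integral_sqReProj_correlate (σ τ : ℝ) :
    ∫ p : ℂ × ℂ, sqReProj p.1 (σ * p.1 + τ * p.2)
      ∂(complexStdGaussian.prod complexStdGaussian) = σ ^ 2 + τ ^ 2 / 2 := by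
  rw [integral_prod _ (integrable_sqReProj_correlate σ τ)]
  have h0 : ∀ᵐ z ∂complexStdGaussian, z ≠ 0 := by
    rw [ae_iff]
    simpa using complexStdGaussian_singleton_zero
  rw [integral_congr_ae (h0.mono fun z hz => integral_sqReProj_affine hz σ τ),
    integral_add (integrable_norm_sq_complexStdGaussian.const_mul _) (integrable_const _),
    integral_const_mul, integral_norm_sq_complexStdGaussian]
  simp

lemma lintegral_sqReProjLoss_le {lam : ℝ} (hlam : 0 < lam) (b : ℂ) :
    ∫⁻ z, ENNReal.ofReal (sqReProjLoss lam z b) ≤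
      ENNReal.ofReal (Real.pi * (‖b‖ ^ 4 / (2 * lam ^ 2))) := by
  have hmeas : Measurable fun z => ENNReal.ofReal (sqReProjLoss lam z b) :=
    ((measurable_sqReProjLoss lam).comp (measurable_prodMk_right (y := b))).ennreal_ofReal
  set J := ∫⁻ z, ENNReal.ofReal (sqReProjLoss lam z b) with hJ
  have hrot : ∫⁻ z, ENNReal.ofReal (sqReProjLoss lam (Complex.I * z) b) = J := by
    have hmp := (rotation
      (⟨Complex.I, mem_sphere_zero_iff_norm.2 Complex.norm_I⟩ : Circle)).measurePreserving
    exact hmp.lintegral_comp hmeas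
  have hle (z : ℂ) : sqReProjLoss lam z b + sqReProjLoss lam (Complex.I * z) b ≤
      (Metric.ball (0 : ℂ) (‖b‖ / lam)).indicator (fun _ => ‖b‖ ^ 2) z := by
    have hmem : z ∈ Metric.ball (0 : ℂ) (‖b‖ / lam) ↔ lam * ‖z‖ < ‖b‖ := by
      rw [mem_ball_zero_iff, lt_div_iff₀ hlam, mul_comm]
    by_cases hz : lam * ‖z‖ < ‖b‖
    · rw [Set.indicator_of_mem (hmem.2 hz)]
      simp only [sqReProjLoss, norm_mul, Complex.norm_I, one_mul, hz, if_true, sqReProj]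
      rw [← add_div]
      refine div_le_of_le_mul₀ (by positivity) (by positivity) (le_of_eq ?_)
      simp [Complex.sq_norm, Complex.normSq_apply]
      ring
    · rw [Set.indicator_of_notMem (mt hmem.1 hz)]
      simp [sqReProjLoss, hz]
  have h2 : J + J ≤ ENNReal.ofReal (‖b‖ ^ 2 * ((‖b‖ / lam) ^ 2 * Real.pi)) := by
    calc J + J = ∫⁻ z, (ENNReal.ofReal (sqReProjLoss lam z b) +
          ENNReal.ofReal (sqReProjLoss lam (Complex.I * z) b)) := by
          rw [lintegral_add_left hmeas, hrot]
      _ ≤ ∫⁻ z, (Metric.ball (0 : ℂ) (‖b‖ / lam)).indicator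
            (fun _ => ENNReal.ofReal (‖b‖ ^ 2)) z := by
          refine lintegral_mono fun z => ?_
          rw [← ENNReal.ofReal_add (sqReProjLoss_nonneg _ _ _) (sqReProjLoss_nonneg _ _ _)]
          refine (ENNReal.ofReal_le_ofReal (hle z)).trans (le_of_eq ?_)
          by_cases hz : z ∈ Metric.ball (0 : ℂ) (‖b‖ / lam) <;> simp [hz]
      _ = _ := by
          rw [lintegral_indicator_const Metric.isOpen_ball.measurableSet, Complex.volume_ball,
            ENNReal.ofReal_mul (by positivity), ENNReal.ofReal_mul (by positivity),
            ENNReal.ofReal_pow (by positivity : 0 ≤ ‖b‖ / lam)]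
          congr 2
          exact (ENNReal.ofReal_coe_nnreal (p := NNReal.pi)).symm
  by_contra! hlt
  refine absurd h2 (not_le.2 ?_)
  refine lt_of_eq_of_lt ?_ (ENNReal.add_lt_add hlt hlt)
  rw [← ENNReal.ofReal_add (by positivity) (by positivity)]
  congr 1
  field_simp
  ring

lemma lintegral_comp_add_smul_complex (F : ℂ → ENNReal) (hF : Measurable F) (a : ℂ) {τ : ℝ}
    (hτ : τ ≠ 0) :
    ∫⁻ v : ℂ, F (a + τ * v) = ENNReal.ofReal (τ ^ 2)⁻¹ * ∫⁻ z, F z := by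
  have h := lintegral_map (μ := (volume : Measure ℂ)) (f := fun z => F (a + z)) (by fun_prop)
    (measurable_const_smul τ)
  rw [Measure.map_addHaar_smul _ hτ, lintegral_smul_measure, lintegral_add_left_eq_self] at h
  simp only [Complex.finrank_real_complex, abs_inv, abs_pow, sq_abs, smul_eq_mul,
    Complex.real_smul] at h
  exact h.symm

lemma integral_sqReProjLoss_swap_le {lam σ τ : ℝ} (hlam : 0 < lam) (hτ : τ ≠ 0) :
    ∫ p : ℂ × ℂ, sqReProjLoss lam (σ * p.1 + τ * p.2) p.1
      ∂(complexStdGaussian.prod complexStdGaussian) ≤ 1 / (lam ^ 2 * τ ^ 2) := by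
  have hmeas : Measurable fun p : ℂ × ℂ => sqReProjLoss lam (σ * p.1 + τ * p.2) p.1 := by
    fun_prop
  rw [integral_eq_lintegral_of_nonneg_ae
    (Filter.Eventually.of_forall fun _ => sqReProjLoss_nonneg _ _ _) hmeas.aestronglyMeasurable]
  refine ENNReal.toReal_le_of_le_ofReal (by positivity) ?_
  rw [lintegral_prod _ hmeas.ennreal_ofReal.aemeasurable]
  have hinner (b : ℂ) : ∫⁻ v, ENNReal.ofReal (sqReProjLoss lam (σ * b + τ * v) b)
      ∂complexStdGaussian ≤ ENNReal.ofReal (1 / (2 * lam ^ 2 * τ ^ 2) * ‖b‖ ^ 4) := by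
    have hz : Measurable fun z => ENNReal.ofReal (sqReProjLoss lam z b) :=
      ((measurable_sqReProjLoss lam).comp (measurable_prodMk_right (y := b))).ennreal_ofReal
    refine (lintegral_complexStdGaussian_le _ (hz.comp (by fun_prop))).trans ?_
    have h := lintegral_comp_add_smul_complex _ hz (σ * b) hτ
    simp only [Function.comp_def]
    rw [h]
    calc _ ≤ ENNReal.ofReal Real.pi⁻¹ * (ENNReal.ofReal (τ ^ 2)⁻¹ *
          ENNReal.ofReal (Real.pi * (‖b‖ ^ 4 / (2 * lam ^ 2)))) := by
          gcongr
          exact lintegral_sqReProjLoss_le hlam b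
      _ = _ := by
          rw [← ENNReal.ofReal_mul (by positivity), ← ENNReal.ofReal_mul (by positivity)]
          congr 1
          field_simp
  refine (lintegral_mono hinner).trans (le_of_eq ?_)
  rw [← ofReal_integral_eq_lintegral_ofReal
    (integrable_norm_pow_four_complexStdGaussian.const_mul _)
    (Filter.Eventually.of_forall fun _ => by positivity), integral_const_mul,
    integral_norm_pow_four_complexStdGaussian]
  congr 1
  field_simp

lemma integral_sqReProjLoss_correlate_le {lam σ τ : ℝ} (hlam : 0 < lam) (hσ : |σ| < lam) :
    ∫ p : ℂ × ℂ, sqReProjLoss lam p.1 (σ * p.1 + τ * p.2)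
      ∂(complexStdGaussian.prod complexStdGaussian) ≤ τ ^ 2 / (1 - |σ| / lam) ^ 2 := by
  have hpos : 0 < 1 - |σ| / lam := by
    rw [sub_pos, div_lt_one hlam]
    exact hσ
  have hint : Integrable (fun p : ℂ × ℂ => τ ^ 2 / (1 - |σ| / lam) ^ 2 * ‖p.2‖ ^ 2)
      (complexStdGaussian.prod complexStdGaussian) :=
    (integrable_norm_sq_complexStdGaussian.comp_snd complexStdGaussian).const_mul _
  refine (integral_mono_of_nonneg (Filter.Eventually.of_forall fun _ => sqReProjLoss_nonneg _ _ _)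
    hint (Filter.Eventually.of_forall fun p => ?_)).trans (le_of_eq ?_)
  · simp only [sqReProjLoss]
    split_ifs with h
    · refine (sqReProj_le _ _).trans ?_
      have hz : ‖p.1‖ ≤ ‖(σ : ℂ) * p.1 + τ * p.2‖ / lam := by
        rw [le_div_iff₀ hlam, mul_comm]
        exact h.le
      have htri := norm_add_le ((σ : ℂ) * p.1) (τ * p.2)
      simp only [norm_mul, Complex.norm_real, Real.norm_eq_abs] at htri
      have hb : ‖(σ : ℂ) * p.1 + τ * p.2‖ * (1 - |σ| / lam) ≤ |τ| * ‖p.2‖ := by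
        have := mul_le_mul_of_nonneg_left hz (abs_nonneg σ)
        have e : |σ| * (‖(σ : ℂ) * p.1 + τ * p.2‖ / lam) =
          ‖(σ : ℂ) * p.1 + τ * p.2‖ * (|σ| / lam) := by ring
        linarith
      rw [div_mul_eq_mul_div, le_div_iff₀ (by positivity), ← mul_pow, ← sq_abs τ, ← mul_pow]
      gcongr
    · positivity
  · rw [integral_const_mul, integral_fun_snd (fun z : ℂ => ‖z‖ ^ 2),
      integral_norm_sq_complexStdGaussian]
    simp

lemma integral_conjPairing_eq {n : ℕ} {x h : Fin n → ℂ} {σ τ : ℝ}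
    (hx : ∑ j, ‖x j‖ ^ 2 = 1) (hh : ∑ j, ‖h j‖ ^ 2 = 1)
    (hσ : ∑ j, (starRingEnd ℂ) (h j) * x j = σ) (hτ : σ ^ 2 + τ ^ 2 = 1)
    {f : ℂ × ℂ → ℝ} (hf : Measurable f) :
    ∫ ξ, f (conjPairing x ξ, conjPairing h ξ) ∂(complexStdGaussianVec n) =
      ∫ p : ℂ × ℂ, f (p.1, σ * p.1 + τ * p.2)
        ∂(complexStdGaussian.prod complexStdGaussian) := by
  have h1 := integral_map (μ := complexStdGaussianVec n) (f := f)
    ((conjPairing x).prod (conjPairing h)).continuous.measurable.aemeasurable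
    hf.aestronglyMeasurable
  have h2 := integral_map (μ := complexStdGaussian.prod complexStdGaussian) (f := f)
    (correlate σ τ).continuous.measurable.aemeasurable hf.aestronglyMeasurable
  rw [map_conjPairing_prod hx hh hσ hτ] at h1
  simp only [correlate_apply] at h2
  exact h1.symm.trans h2

lemma le_one_eighth_add_of_loss_bounds {lam σ : ℝ} (hlam : (2.95 : ℝ) ≤ lam) (hσ : |σ| ≤ 1) {L : ℝ}
    (h₁ : 1 - σ ^ 2 ≠ 0 → L ≤ 1 / (lam ^ 2 * (1 - σ ^ 2)))
    (h₂ : L ≤ (1 - σ ^ 2) / (1 - |σ| / lam) ^ 2) : L ≤ 1 / 8 + σ ^ 2 / 2 := by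
  rw [← sq_abs σ] at *
  have hs0 := abs_nonneg σ
  generalize |σ| = s at *
  rcases le_total s 0.875 with hs | hs
  · have hpos : 0 < 1 - s ^ 2 := by nlinarith
    refine (h₁ hpos.ne').trans ?_
    rw [div_le_iff₀ (by positivity)]
    have hl : (2.95 : ℝ) ^ 2 ≤ lam ^ 2 := by gcongr
    have ht : (0 : ℝ) ≤ s ^ 2 := by positivity
    have ht' : s ^ 2 ≤ 0.875 ^ 2 := by gcongr
    have hc : 1 ≤ (2.95 : ℝ) ^ 2 * ((1 - s ^ 2) * (1 / 8 + s ^ 2 / 2)) := by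
      nlinarith [mul_nonneg ht (sub_nonneg.2 ht')]
    have := mul_le_mul_of_nonneg_right hl
      (show 0 ≤ (1 - s ^ 2) * (1 / 8 + s ^ 2 / 2) by positivity)
    linarith
  · refine h₂.trans ?_
    have hq : s / lam ≤ 0.339 * s := by
      rw [div_le_iff₀ (by linarith)]
      nlinarith
    have hpos : 0 < 1 - 0.339 * s := by linarith
    have hsq : (1 - 0.339 * s) ^ 2 ≤ (1 - s / lam) ^ 2 := by gcongr
    rw [div_le_iff₀ (lt_of_lt_of_le (by positivity) hsq)]
    have hc : 1 - s ^ 2 ≤ (1 / 8 + s ^ 2 / 2) * (1 - 0.339 * s) ^ 2 := by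
      have h1 : (0.661 : ℝ) ^ 2 ≤ (1 - 0.339 * s) ^ 2 := by
        gcongr
        linarith
      rcases le_total s 0.9 with h9 | h9
      · have h2 : (0.694 : ℝ) ^ 2 ≤ (1 - 0.339 * s) ^ 2 := by
          gcongr
          linarith
        nlinarith
      · nlinarith
    refine hc.trans ?_
    gcongr

theorem stmt_16 (n : ℕ) (x h : Fin n → ℂ)
    (hx : ∑ j, ‖x j‖^2 = 1) (hh : ∑ j, ‖h j‖^2 = 1)
    (him : (∑ j, (starRingEnd ℂ) (h j) * x j).im = 0)
    (lam : ℝ) (hlam : (2.95:ℝ) ≤ lam) :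
    (∫ ξ in {ξ : Fin n → ℂ |
        lam * ‖∑ j, (starRingEnd ℂ) (ξ j) * x j‖ ≥ ‖∑ j, (starRingEnd ℂ) (ξ j) * h j‖},
        ((∑ j, (starRingEnd ℂ) (h j) * ξ j) * (∑ j, (starRingEnd ℂ) (ξ j) * x j)).re ^ 2
          / ‖∑ j, (starRingEnd ℂ) (ξ j) * x j‖^2 ∂(complexStdGaussianVec n))
      ≥ 3/8 - 1/(lam+1)^2 := by
  obtain ⟨σ, hσ⟩ : ∃ σ : ℝ, ∑ j, (starRingEnd ℂ) (h j) * x j = σ :=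
    ⟨_, Complex.ext rfl (by simpa using him)⟩
  have hσ' : ∑ j, (starRingEnd ℂ) (x j) * h j = σ := by
    have := congrArg (starRingEnd ℂ) hσ
    simpa [mul_comm] using this
  have hσ1 : |σ| ≤ 1 := by
    have hnorm : ‖(σ : ℂ)‖ ≤ ∑ j, ‖h j‖ * ‖x j‖ := by
      rw [← hσ]
      refine (norm_sum_le _ _).trans (le_of_eq ?_)
      simp
    rw [Complex.norm_real, Real.norm_eq_abs] at hnorm
    have hcs := Finset.sum_mul_sq_le_sq_mul_sq Finset.univ (fun j => ‖h j‖) (fun j => ‖x j‖)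
    rw [hx, hh, mul_one] at hcs
    exact hnorm.trans (abs_le_one_iff_mul_self_le_one.2 (by linarith [hcs]) |> le_of_abs_le)
  have hσsq : 0 ≤ 1 - σ ^ 2 := by
    rw [sub_nonneg, ← sq_abs]
    exact pow_le_one₀ (abs_nonneg σ) hσ1
  set τ := √(1 - σ ^ 2) with hτdef
  have hτsq : τ ^ 2 = 1 - σ ^ 2 := Real.sq_sqrt hσsq
  have hτ : σ ^ 2 + τ ^ 2 = 1 := by linarith
  have hlam0 : 0 < lam := by linarith
  have hloss : ∫ p : ℂ × ℂ, sqReProjLoss lam p.1 (σ * p.1 + τ * p.2)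
      ∂(complexStdGaussian.prod complexStdGaussian) ≤ 1 / 8 + σ ^ 2 / 2 := by
    refine le_one_eighth_add_of_loss_bounds hlam hσ1 (fun hne => ?_) ?_
    · rw [← hτsq] at hne ⊢
      have hswap := integral_conjPairing_eq hx hh hσ hτ (measurable_sqReProjLoss lam)
      have hswap' := integral_conjPairing_eq hh hx hσ' hτ
        ((measurable_sqReProjLoss lam).comp measurable_swap)
      simp only [Function.comp_def, Prod.fst_swap, Prod.snd_swap] at hswap'
      rw [← hswap, hswap']
      exact integral_sqReProjLoss_swap_le hlam0 (by simpa using hne)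
    · rw [← hτsq]
      exact integral_sqReProjLoss_correlate_le hlam0 (by linarith)
  have hset : MeasurableSet {ξ : Fin n → ℂ |
      lam * ‖∑ j, (starRingEnd ℂ) (ξ j) * x j‖ ≥ ‖∑ j, (starRingEnd ℂ) (ξ j) * h j‖} :=
    (isClosed_le (by fun_prop) (by fun_prop)).measurableSet
  rw [← integral_indicator hset]
  have hind (ξ : Fin n → ℂ) : Set.indicator {ξ : Fin n → ℂ |
      lam * ‖∑ j, (starRingEnd ℂ) (ξ j) * x j‖ ≥ ‖∑ j, (starRingEnd ℂ) (ξ j) * h j‖}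
      (fun ξ => ((∑ j, (starRingEnd ℂ) (h j) * ξ j) *
        (∑ j, (starRingEnd ℂ) (ξ j) * x j)).re ^ 2 / ‖∑ j, (starRingEnd ℂ) (ξ j) * x j‖ ^ 2) ξ =
      sqReProj (conjPairing x ξ) (conjPairing h ξ) -
        sqReProjLoss lam (conjPairing x ξ) (conjPairing h ξ) := by
    have hconj : conjPairing ξ h = (starRingEnd ℂ) (conjPairing h ξ) := by
      simp [conjPairing_apply, mul_comm]
    simp only [Set.indicator_apply, Set.mem_ofPred_eq, ← conjPairing_apply, sqReProjLoss,
      ge_iff_le, sqReProj, hconj]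
    by_cases hb : ‖conjPairing h ξ‖ ≤ lam * ‖conjPairing x ξ‖
    · rw [if_pos hb, if_neg (not_lt.2 hb), sub_zero]
    · rw [if_neg hb, if_pos (not_le.1 hb), sub_self]
  simp_rw [hind]
  have htransfer := integral_conjPairing_eq hx hh hσ hτ
    (measurable_sqReProj.sub (measurable_sqReProjLoss lam))
  simp only [Pi.sub_apply] at htransfer
  have hint := integrable_sqReProj_correlate σ τ
  have hmeas : Measurable fun p : ℂ × ℂ => sqReProjLoss lam p.1 (σ * p.1 + τ * p.2) := by
    fun_prop
  have hintLoss : Integrable (fun p : ℂ × ℂ => sqReProjLoss lam p.1 (σ * p.1 + τ * p.2))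
      (complexStdGaussian.prod complexStdGaussian) := by
    refine hint.mono' hmeas.aestronglyMeasurable (Filter.Eventually.of_forall fun p => ?_)
    rw [Real.norm_of_nonneg (sqReProjLoss_nonneg _ _ _)]
    exact sqReProjLoss_le _ _ _
  rw [htransfer, integral_sub hint hintLoss, integral_sqReProj_correlate, hτsq]
  have : 0 ≤ 1 / (lam + 1) ^ 2 := by positivity
  linarith
end
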